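/- Consider a finite-horizon discounted MDP skeleton (S, A, T, R, R_max, γ) with horizon D, optimal value functions V*_d, restricted value functions V̂_d defined from nonempty subsets A'(s,d) ⊆ A with Q̂_d(s,a) = R(s,a) + γ ∫_S V̂_{d+1} dT(s,a), and sample-based estimates W_d defined by W_D = 0 and W_d(s) = ⨆_{a∈A'(s,d)} ( R(s,a) + γ·M_d(s,a)(W_{d+1}) ), where each M_d(s,a) is a normalized finitely-supported weighted average M_d(s,a)(f) = ( Σᵢ w_{d,s,a,i} f(s_{d,s,a,i}) ) / ( Σᵢ w_{d,s,a,i} ) with weights w_{d,s,a,i} ≥ 0 of positive sum. Suppose there are ρ ≥ 0 and ε ≥ 0 such that for all s ∈ S and 0 ≤ d < D: (i) ⨆_{a∈A} Q̂_d(s,a) − ⨆_{a∈A'(s,d)} Q̂_d(s,a) ≤ ρ, and (ii) |M_d(s,a)(V̂_{d+1}) − ∫_S V̂_{d+1} dT(s,a)| ≤ ε for all a ∈ A. Then for every 0 ≤ d ≤ D and every s ∈ S, |V*_d(s) − W_d(s)| ≤ (ρ + γε)·(1 − γ^{D−d})/(1 − γ) ≤ (ρ + γε)/(1 − γ). (This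 is the deterministic skeleton of the VOSS Inequality: combining the action-selection regret bound and the sparse-sampling concentration bound via the triangle inequality yields a global value-estimation bound η + α.) -/

import Mathlib

open MeasureTheory

lemma bddAbove_range_of_abs_sub_le {ι : Type*} {f g : ι → ℝ} {c : ℝ}
    (hg : BddAbove (Set.range g)) (h : ∀ i, |f i - g i| ≤ c) : BddAbove (Set.range f) := by
  obtain ⟨b, hb⟩ := hg
  refine ⟨b + c, ?_⟩
  rintro _ ⟨i, rfl⟩
  linarith [hb (Set.mem_range_self i), (abs_le.mp (h i)).2]

lemma abs_iSup_sub_iSup_le {ι : Type*} [Nonempty ι] {f g : ι → ℝ} {c : ℝ}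
    (hg : BddAbove (Set.range g)) (h : ∀ i, |f i - g i| ≤ c) :
    |(⨆ i, f i) - ⨆ i, g i| ≤ c := by
  have hf := bddAbove_range_of_abs_sub_le hg h
  have h₁ : (⨆ i, f i) ≤ (⨆ i, g i) + c := ciSup_le fun i ↦ by
    linarith [le_ciSup hg i, (abs_le.mp (h i)).2]
  have h₂ : (⨆ i, g i) ≤ (⨆ i, f i) + c := ciSup_le fun i ↦ by
    linarith [le_ciSup hf i, (abs_le.mp (h i)).1]
  exact abs_le.mpr ⟨by linarith, by linarith⟩

lemma bddAbove_range_of_abs_le {ι : Type*} {f : ι → ℝ} {c : ℝ} (h : ∀ i, |f i| ≤ c) :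
    BddAbove (Set.range f) :=
  ⟨c, Set.forall_mem_range.mpr fun i ↦ (le_abs_self _).trans (h i)⟩

lemma abs_iSup_le_of_abs_le {ι : Type*} [Nonempty ι] {f : ι → ℝ} {c : ℝ}
    (h : ∀ i, |f i| ≤ c) : |⨆ i, f i| ≤ c := by
  simpa using abs_iSup_sub_iSup_le (f := f) (g := fun _ ↦ 0)
    (bddAbove_range_of_abs_le (c := 0) (by simp)) (by simpa using h)

lemma abs_integral_le_of_abs_le {S : Type*} [MeasurableSpace S] {μ : Measure S}
    [IsProbabilityMeasure μ] {f : S → ℝ} {c : ℝ} (h : ∀ x, |f x| ≤ c) :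
    |∫ x, f x ∂μ| ≤ c := by
  simpa using norm_integral_le_of_norm_le_const (μ := μ) (f := f) (C := c) (.of_forall h)

lemma abs_integral_sub_integral_le {S : Type*} [MeasurableSpace S] {μ : Measure S}
    [IsProbabilityMeasure μ] {f g : S → ℝ} {c : ℝ} (hf : Integrable f μ) (hg : Integrable g μ)
    (h : ∀ x, |f x - g x| ≤ c) : |∫ x, f x ∂μ - ∫ x, g x ∂μ| ≤ c := by
  rw [← integral_sub hf hg]
  exact abs_integral_le_of_abs_le h

lemma integrable_of_measurable_of_abs_le {S : Type*} [MeasurableSpace S] {μ : Measure S}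
    [IsProbabilityMeasure μ] {f : S → ℝ} {c : ℝ} (hf : Measurable f) (h : ∀ x, |f x| ≤ c) :
    Integrable f μ :=
  .of_bound hf.aestronglyMeasurable c (.of_forall h)

lemma abs_weightedAverage_sub_le {ι : Type*} [Fintype ι] {w f g : ι → ℝ} {c : ℝ}
    (hw : ∀ i, 0 ≤ w i) (hwsum : 0 < ∑ i, w i) (h : ∀ i, |f i - g i| ≤ c) :
    |(∑ i, w i * f i) / (∑ i, w i) - (∑ i, w i * g i) / (∑ i, w i)| ≤ c := by
  rw [← sub_div, abs_div, abs_of_pos hwsum, div_le_iff₀ hwsum, ← Finset.sum_sub_distrib,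
    Finset.mul_sum]
  refine (Finset.abs_sum_le_sum_abs _ _).trans (Finset.sum_le_sum fun i _ ↦ ?_)
  rw [← mul_sub, abs_mul, abs_of_nonneg (hw i), mul_comm]
  exact mul_le_mul_of_nonneg_right (h i) (hw i)

lemma abs_reward_add_discount_mul_le {r v γ b c : ℝ} (hγ : 0 ≤ γ) (hr : |r| ≤ b)
    (hv : |v| ≤ c) : |r + γ * v| ≤ b + γ * c := by
  refine (abs_add_le _ _).trans (add_le_add hr ?_)
  rw [abs_mul, abs_of_nonneg hγ]
  exact mul_le_mul_of_nonneg_left hv hγ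

lemma abs_reward_add_discount_mul_sub_le {r u v γ c : ℝ} (hγ : 0 ≤ γ) (h : |u - v| ≤ c) :
    |r + γ * u - (r + γ * v)| ≤ γ * c := by
  rw [add_sub_add_left_eq_sub, ← mul_sub, abs_mul, abs_of_nonneg hγ]
  exact mul_le_mul_of_nonneg_left h hγ

lemma measurable_integral_of_measurable {S : Type*} [MeasurableSpace S] {κ : S → Measure S}
    (hκ : Measurable κ) (hprob : ∀ s, IsProbabilityMeasure (κ s)) {f : S → ℝ}
    (hf : Measurable f) : Measurable fun s ↦ ∫ x, f x ∂(κ s) := by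
  let k : ProbabilityTheory.Kernel S S := ⟨κ, hκ⟩
  have : ProbabilityTheory.IsMarkovKernel k := ⟨hprob⟩
  exact (hf.stronglyMeasurable.integral_kernel (κ := k)).measurable

/-- Deterministic skeleton of the VOSS Inequality: combining the per-node action-selection
regret bound `ρ` and the per-node sparse-sampling concentration bound `ε` yields
`|V*_d(s) − W_d(s)| ≤ (ρ + γε)·(1 − γ^(D−d))/(1 − γ) ≤ (ρ + γε)/(1 − γ)`. -/
theorem voss_inequality_skeleton
    {S : Type*} [MeasurableSpace S]
    {A : Type*} [Countable A] [Nonempty A]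
    (T : S → A → Measure S) (hT : ∀ s a, IsProbabilityMeasure (T s a))
    (hTmeas : ∀ a : A, Measurable fun s => T s a)
    (R : S → A → ℝ) (hRmeas : ∀ a : A, Measurable fun s => R s a)
    (Rmax : ℝ) (hRmax : 0 ≤ Rmax) (hR : ∀ s a, |R s a| ≤ Rmax)
    (γ : ℝ) (hγ0 : 0 ≤ γ) (hγ1 : γ < 1)
    (D : ℕ)
    (Vstar : ℕ → S → ℝ)
    (hVstarD : ∀ s, Vstar D s = 0)
    (hVstar : ∀ d, d < D → ∀ s,
      Vstar d s = ⨆ a : A, (R s a + γ * ∫ x, Vstar (d + 1) x ∂(T s a)))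
    (A' : S → ℕ → Set A) (hA' : ∀ s d, (A' s d).Nonempty)
    (Vhat : ℕ → S → ℝ)
    (hVhatMeas : ∀ d, Measurable (Vhat d))
    (hVhatD : ∀ s, Vhat D s = 0)
    (hVhat : ∀ d, d < D → ∀ s,
      Vhat d s = ⨆ a : A' s d, (R s ↑a + γ * ∫ x, Vhat (d + 1) x ∂(T s ↑a)))
    -- sample states and nonnegative weights of positive sum at every node
    (C : ℕ) (σ : ℕ → S → A → Fin C → S) (w : ℕ → S → A → Fin C → ℝ)
    (hw : ∀ d s a i, 0 ≤ w d s a i)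
    (hwsum : ∀ d s a, 0 < ∑ i, w d s a i)
    -- the normalized finitely-supported weighted average
    (M : ℕ → S → A → (S → ℝ) → ℝ)
    (hM : ∀ d s a f, M d s a f = (∑ i, w d s a i * f (σ d s a i)) / (∑ i, w d s a i))
    -- sample-based estimates
    (W : ℕ → S → ℝ)
    (hWD : ∀ s, W D s = 0)
    (hW : ∀ d, d < D → ∀ s,
      W d s = ⨆ a : A' s d, (R s ↑a + γ * M d s ↑a (W (d + 1))))
    -- (i) per-node action-selection regret
    (ρ : ℝ) (hρ : 0 ≤ ρ)
    (hregret : ∀ s, ∀ d, d < D →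
      (⨆ a : A, (R s a + γ * ∫ x, Vhat (d + 1) x ∂(T s a))) -
        (⨆ a : A' s d, (R s ↑a + γ * ∫ x, Vhat (d + 1) x ∂(T s ↑a))) ≤ ρ)
    -- (ii) per-node concentration error
    (ε : ℝ) (hε : 0 ≤ ε)
    (hconc : ∀ d, d < D → ∀ s, ∀ a : A,
      |M d s a (Vhat (d + 1)) - ∫ x, Vhat (d + 1) x ∂(T s a)| ≤ ε) :
    ∀ d ≤ D, ∀ s,
      |Vstar d s - W d s| ≤ (ρ + γ * ε) * (1 - γ ^ (D - d)) / (1 - γ) ∧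
      (ρ + γ * ε) * (1 - γ ^ (D - d)) / (1 - γ) ≤ (ρ + γ * ε) / (1 - γ) := by
  intro d hd s
  have h1γ : 0 < 1 - γ := by linarith
  have hne : ∀ s d, Nonempty (A' s d) := fun s d ↦ (hA' s d).to_subtype
  have hVstarReg : ∀ n d, d + n = D → Measurable (Vstar d) ∧ ∃ K, ∀ s, |Vstar d s| ≤ K := by
    intro n
    induction n with
    | zero =>
      rintro d rfl
      have h0 : Vstar d = fun _ ↦ 0 := funext hVstarD
      rw [h0]
      exact ⟨measurable_const, 0, by simp⟩
    | succ n ih =>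
      intro d hdn
      obtain ⟨hm, K, hK⟩ := ih (d + 1) (by omega)
      have heq := funext (hVstar d (by omega))
      rw [heq]
      exact ⟨.iSup fun a ↦ (hRmeas a).add
          ((measurable_integral_of_measurable (hTmeas a) (hT · a) hm).const_mul γ),
        Rmax + γ * K, fun s ↦ abs_iSup_le_of_abs_le fun a ↦
          abs_reward_add_discount_mul_le hγ0 (hR s a) (abs_integral_le_of_abs_le hK)⟩
  have hVhatBdd : ∀ n d, d + n = D → ∃ K, ∀ s, |Vhat d s| ≤ K := by
    intro n
    induction n with
    | zero =>
      rintro d rfl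
      exact ⟨0, fun s ↦ (abs_eq_zero.mpr (hVhatD s)).le⟩
    | succ n ih =>
      intro d hdn
      obtain ⟨K, hK⟩ := ih (d + 1) (by omega)
      refine ⟨Rmax + γ * K, fun s ↦ ?_⟩
      rw [hVhat d (by omega) s]
      exact abs_iSup_le_of_abs_le fun a ↦
        abs_reward_add_discount_mul_le hγ0 (hR s a) (abs_integral_le_of_abs_le hK)
  have hsum : ∀ c : ℝ, ∀ n : ℕ,
      c * (1 - γ ^ (n + 1)) / (1 - γ) = c + γ * (c * (1 - γ ^ n) / (1 - γ)) := by
    intro c n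
    field_simp
    ring
  have herr : ∀ n d, d + n = D → ∀ s,
      |Vstar d s - Vhat d s| ≤ ρ * (1 - γ ^ n) / (1 - γ) ∧
      |Vhat d s - W d s| ≤ γ * ε * (1 - γ ^ n) / (1 - γ) := by
    intro n
    induction n with
    | zero =>
      rintro d rfl s
      rw [add_zero] at hVstarD hVhatD hWD
      simp [hVstarD, hVhatD, hWD]
    | succ n ih =>
      intro d hdn s
      have hdD : d < D := by omega
      have hstep := ih (d + 1) (by omega)
      obtain ⟨hm, K, hK⟩ := hVstarReg n (d + 1) (by omega)
      obtain ⟨L, hL⟩ := hVhatBdd n (d + 1) (by omega)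
      have hQ : ∀ a, |R s a + γ * ∫ x, Vhat (d + 1) x ∂(T s a)| ≤ Rmax + γ * L := fun a ↦
        abs_reward_add_discount_mul_le hγ0 (hR s a) (abs_integral_le_of_abs_le hL)
      have hQA := bddAbove_range_of_abs_le hQ
      have hQA' := bddAbove_range_of_abs_le fun a : A' s d ↦ hQ a
      constructor
      · have hstar := abs_iSup_sub_iSup_le
          (f := fun a ↦ R s a + γ * ∫ x, Vstar (d + 1) x ∂(T s a)) hQA fun a ↦
          abs_reward_add_discount_mul_sub_le hγ0 (abs_integral_sub_integral_le
            (integrable_of_measurable_of_abs_le hm hK)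
            (integrable_of_measurable_of_abs_le (hVhatMeas _) hL) fun x ↦ (hstep x).1)
        have hle : (⨆ a : A' s d, (R s a + γ * ∫ x, Vhat (d + 1) x ∂(T s a))) ≤
            ⨆ a : A, (R s a + γ * ∫ x, Vhat (d + 1) x ∂(T s a)) :=
          ciSup_le fun a ↦ le_ciSup hQA (a : A)
        have hr := hregret s d hdD
        rw [hVstar d hdD, hVhat d hdD, hsum]
        rw [abs_le] at hstar ⊢
        exact ⟨by linarith, by linarith⟩
      · have hM' : ∀ a : A, |M d s a (W (d + 1)) - ∫ x, Vhat (d + 1) x ∂(T s a)| ≤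
            ε + γ * ε * (1 - γ ^ n) / (1 - γ) := by
          intro a
          have havg : |M d s a (Vhat (d + 1)) - M d s a (W (d + 1))| ≤
              γ * ε * (1 - γ ^ n) / (1 - γ) := by
            rw [hM, hM]
            exact abs_weightedAverage_sub_le (hw d s a) (hwsum d s a) fun i ↦ (hstep _).2
          have hc := hconc d hdD s a
          rw [abs_le] at havg hc ⊢
          exact ⟨by linarith, by linarith⟩
        rw [hW d hdD, hVhat d hdD, hsum, abs_sub_comm, ← mul_add]
        exact abs_iSup_sub_iSup_le hQA' fun a ↦
          abs_reward_add_discount_mul_sub_le hγ0 (hM' a)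
  constructor
  · obtain ⟨h₁, h₂⟩ := herr (D - d) d (by omega) s
    rw [add_mul, add_div]
    exact (abs_sub_le _ (Vhat d s) _).trans (add_le_add h₁ h₂)
  · refine div_le_div_of_nonneg_right ?_ h1γ.le
    have hc : 0 ≤ ρ + γ * ε := by positivity
    exact mul_le_of_le_one_right hc (by linarith [pow_nonneg hγ0 (D - d)])
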